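/- (Lemma 1, forward dynamic programming / Kalman filter value function.) Let F ∈ ℝ^{n×n}, H ∈ ℝ^{m×n}, let Q, P₀ ∈ ℝ^{n×n} and R ∈ ℝ^{m×m} be symmetric positive definite, let x̂₀ ∈ ℝⁿ, and let y₀,…,y_{N−1} ∈ ℝ^m be given. For 0 ≤ t ≤ N and x ∈ ℝⁿ define V_t(x) as the infimum over (x₀,…,x_{t−1}) ∈ (ℝⁿ)ᵗ, with x_t := x, of |x₀ − x̂₀|²_{P₀⁻¹} + Σ_{k=0}^{t−1} ( |x_{k+1} − F x_k|²_{Q⁻¹} + |y_k − H x_k|²_{R⁻¹} ). Then for every t and every x ∈ ℝⁿ, this infimum is attained and V_t(x) = |x − x̆_t|²_{P_t⁻¹} + c_t, where P_t, x̆_t, c_t are generated by the Kalman recursions: P₀ given, P_{t+1} = Q + F P_t Fᵀ − F P_t Hᵀ (R + H P_t Hᵀ)⁻¹ H P_t Fᵀ; x̆₀ = x̂₀, x̆_{t+1} = F x̆_t + K_t(y_t − H x̆_t) with K_t = F P_t Hᵀ (R + H P_t Hᵀ)⁻¹; c₀ = 0, c_{t+1} = c_t + |H x̆_t − y_t|²_{(R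 + H P_t Hᵀ)⁻¹}. -/

import Mathlib

open Matrix

/-- Weighted squared norm `|z|²_M = zᵀ M z`. -/
noncomputable def qf {k : ℕ} (M : Matrix (Fin k) (Fin k) ℝ) (z : Fin k → ℝ) : ℝ :=
  z ⬝ᵥ M *ᵥ z

lemma qf_add {k : ℕ} {M : Matrix (Fin k) (Fin k) ℝ} (hM : Mᵀ = M) (a b : Fin k → ℝ) :
    qf M (a + b) = qf M a + 2 * (a ⬝ᵥ M *ᵥ b) + qf M b := by
  have h : b ⬝ᵥ M *ᵥ a = a ⬝ᵥ M *ᵥ b := by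
    rw [dotProduct_mulVec, ← mulVec_transpose, hM, dotProduct_comm]
  simp only [qf, mulVec_add, dotProduct_add, add_dotProduct, h]
  ring

lemma qf_neg {k : ℕ} (M : Matrix (Fin k) (Fin k) ℝ) (a : Fin k → ℝ) : qf M (-a) = qf M a := by
  simp [qf, mulVec_neg]

lemma qf_nonneg {k : ℕ} {M : Matrix (Fin k) (Fin k) ℝ} (hM : M.PosDef) (a : Fin k → ℝ) :
    0 ≤ qf M a := by
  simpa [qf] using hM.posSemidef.dotProduct_mulVec_nonneg a

lemma posDef_transpose_eq {k : ℕ} {M : Matrix (Fin k) (Fin k) ℝ} (hM : M.PosDef) : Mᵀ = M := by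
  simpa [IsHermitian] using hM.isHermitian

lemma posDef_add_mul_mul_transpose {k l : ℕ} {A : Matrix (Fin k) (Fin k) ℝ}
    {B : Matrix (Fin l) (Fin l) ℝ} (hA : A.PosDef) (hB : B.PosDef)
    (C : Matrix (Fin k) (Fin l) ℝ) : (A + C * B * Cᵀ).PosDef := by
  simpa using hA.add_posSemidef (hB.posSemidef.mul_mul_conjTranspose_same C)

/-- The information matrix of a Gaussian measurement update is positive definite. -/
lemma posDef_information {k l : ℕ} {A : Matrix (Fin k) (Fin k) ℝ}
    {B : Matrix (Fin l) (Fin l) ℝ} (hA : A.PosDef) (hB : B.PosDef)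
    (C : Matrix (Fin l) (Fin k) ℝ) : (A⁻¹ + Cᵀ * B⁻¹ * C).PosDef := by
  simpa using posDef_add_mul_mul_transpose hA.inv hB.inv Cᵀ

/-- Completing the square in `z`. -/
lemma qf_inv_add_qf_inv_sub {k l : ℕ} {A : Matrix (Fin k) (Fin k) ℝ}
    {B : Matrix (Fin l) (Fin l) ℝ} (hA : A.PosDef) (hB : B.PosDef)
    (C : Matrix (Fin l) (Fin k) ℝ) (z : Fin k → ℝ) (w : Fin l → ℝ) :
    qf A⁻¹ z + qf B⁻¹ (w - C *ᵥ z) =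
      qf (B + C * A * Cᵀ)⁻¹ w +
        qf (A⁻¹ + Cᵀ * B⁻¹ * C) (z - (A * Cᵀ * (B + C * A * Cᵀ)⁻¹) *ᵥ w) := by
  have hS := posDef_add_mul_mul_transpose hB hA C
  set S := B + C * A * Cᵀ with hSdef
  have hAdet : IsUnit A.det := (isUnit_iff_isUnit_det A).1 hA.isUnit
  have hBdet : IsUnit B.det := (isUnit_iff_isUnit_det B).1 hB.isUnit
  have hSdet : IsUnit S.det := (isUnit_iff_isUnit_det S).1 hS.isUnit
  obtain ⟨s, rfl⟩ : ∃ s, w = S *ᵥ s := ⟨S⁻¹ *ᵥ w, by simp [mul_nonsing_inv _ hSdet]⟩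
  obtain ⟨u, rfl⟩ : ∃ u, z = u + (A * Cᵀ) *ᵥ s := ⟨z - (A * Cᵀ) *ᵥ s, by simp⟩
  have hz : u + (A * Cᵀ) *ᵥ s - (A * Cᵀ * S⁻¹) *ᵥ (S *ᵥ s) = u := by
    rw [mulVec_mulVec, Matrix.mul_assoc, nonsing_inv_mul _ hSdet, Matrix.mul_one,
      add_sub_cancel_right]
  have hw : S *ᵥ s - C *ᵥ (u + (A * Cᵀ) *ᵥ s) = B *ᵥ s + -(C *ᵥ u) := by
    rw [hSdef, add_mulVec, mulVec_add, mulVec_mulVec, ← Matrix.mul_assoc]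
    abel
  have hcross : ∀ v : Fin k → ℝ, v ⬝ᵥ Cᵀ *ᵥ s = s ⬝ᵥ C *ᵥ v := fun v => by
    rw [dotProduct_mulVec, vecMul_transpose, dotProduct_comm]
  have hAs : A⁻¹ *ᵥ ((A * Cᵀ) *ᵥ s) = Cᵀ *ᵥ s := by
    rw [mulVec_mulVec, ← Matrix.mul_assoc, nonsing_inv_mul _ hAdet, Matrix.one_mul]
  have hBs : B⁻¹ *ᵥ (B *ᵥ s) = s := by
    rw [mulVec_mulVec, nonsing_inv_mul _ hBdet, one_mulVec]
  have hSs : S⁻¹ *ᵥ (S *ᵥ s) = s := by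
    rw [mulVec_mulVec, nonsing_inv_mul _ hSdet, one_mulVec]
  have h₁ : qf A⁻¹ ((A * Cᵀ) *ᵥ s) = s ⬝ᵥ (C * A * Cᵀ) *ᵥ s := by
    rw [qf, hAs, hcross, mulVec_mulVec, ← Matrix.mul_assoc]
  have h₂ : qf B⁻¹ (B *ᵥ s) = s ⬝ᵥ B *ᵥ s := by
    rw [qf, hBs, dotProduct_comm]
  have h₃ : qf S⁻¹ (S *ᵥ s) = s ⬝ᵥ B *ᵥ s + s ⬝ᵥ (C * A * Cᵀ) *ᵥ s := by
    rw [qf, hSs, dotProduct_comm, hSdef, add_mulVec, dotProduct_add]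
  have h₄ : B *ᵥ s ⬝ᵥ B⁻¹ *ᵥ (-(C *ᵥ u)) = -(s ⬝ᵥ C *ᵥ u) := by
    rw [dotProduct_mulVec, ← mulVec_transpose, posDef_transpose_eq hB.inv, hBs, dotProduct_neg]
  have h₅ : qf (A⁻¹ + Cᵀ * B⁻¹ * C) u = qf A⁻¹ u + qf B⁻¹ (C *ᵥ u) := by
    rw [qf, add_mulVec, dotProduct_add, qf, qf, Matrix.mul_assoc, ← mulVec_mulVec,
      ← mulVec_mulVec, dotProduct_mulVec u Cᵀ, vecMul_transpose]
  rw [hz, hw, qf_add (posDef_transpose_eq hA.inv), qf_add (posDef_transpose_eq hB.inv),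
    qf_neg, hAs, hcross, h₁, h₂, h₃, h₄, h₅]
  ring

/-- The Woodbury form of the measurement-updated covariance. -/
lemma inv_information_eq {k l : ℕ} {A : Matrix (Fin k) (Fin k) ℝ}
    {B : Matrix (Fin l) (Fin l) ℝ} (hA : A.PosDef) (hB : B.PosDef)
    (C : Matrix (Fin l) (Fin k) ℝ) :
    (A⁻¹ + Cᵀ * B⁻¹ * C)⁻¹ = A - A * Cᵀ * (B + C * A * Cᵀ)⁻¹ * C * A := by
  have hAdet : IsUnit A.det := (isUnit_iff_isUnit_det A).1 hA.isUnit
  have hBdet : IsUnit B.det := (isUnit_iff_isUnit_det B).1 hB.isUnit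
  have h := add_mul_mul_inv_eq_sub A⁻¹ Cᵀ B⁻¹ C hA.inv.isUnit hB.inv.isUnit (by
    rw [nonsing_inv_nonsing_inv _ hAdet, nonsing_inv_nonsing_inv _ hBdet]
    exact (posDef_add_mul_mul_transpose hB hA C).isUnit)
  rwa [nonsing_inv_nonsing_inv _ hAdet, nonsing_inv_nonsing_inv _ hBdet] at h

lemma riccati_eq {n m : ℕ} (F : Matrix (Fin n) (Fin n) ℝ) (H : Matrix (Fin m) (Fin n) ℝ)
    {P : Matrix (Fin n) (Fin n) ℝ} (Q : Matrix (Fin n) (Fin n) ℝ) {R : Matrix (Fin m) (Fin m) ℝ}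
    (hP : P.PosDef) (hR : R.PosDef) :
    Q + F * P * Fᵀ - F * P * Hᵀ * (R + H * P * Hᵀ)⁻¹ * (H * P * Fᵀ) =
      Q + F * (P⁻¹ + Hᵀ * R⁻¹ * H)⁻¹ * Fᵀ := by
  rw [inv_information_eq hP hR H]
  simp only [Matrix.mul_sub, Matrix.sub_mul, Matrix.mul_assoc, add_sub_assoc]

/-- One step of the dynamic programming recursion, as a minimization over the previous state. -/
lemma isLeast_range_kalman_step {n m : ℕ} (F : Matrix (Fin n) (Fin n) ℝ)
    (H : Matrix (Fin m) (Fin n) ℝ) {P Q : Matrix (Fin n) (Fin n) ℝ}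
    {R : Matrix (Fin m) (Fin m) ℝ} (hP : P.PosDef) (hQ : Q.PosDef) (hR : R.PosDef)
    (a x : Fin n → ℝ) (y : Fin m → ℝ) :
    IsLeast
      (Set.range fun z : Fin n → ℝ =>
        qf P⁻¹ (z - a) + (qf Q⁻¹ (x - F *ᵥ z) + qf R⁻¹ (y - H *ᵥ z)))
      (qf (Q + F * P * Fᵀ - F * P * Hᵀ * (R + H * P * Hᵀ)⁻¹ * (H * P * Fᵀ))⁻¹
          (x - (F *ᵥ a + (F * P * Hᵀ * (R + H * P * Hᵀ)⁻¹) *ᵥ (y - H *ᵥ a))) +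
        qf (R + H * P * Hᵀ)⁻¹ (H *ᵥ a - y)) := by
  rw [riccati_eq F H Q hP hR]
  have hL := posDef_information hP hR H
  set L := P⁻¹ + Hᵀ * R⁻¹ * H with hLdef
  set e := (P * Hᵀ * (R + H * P * Hᵀ)⁻¹) *ᵥ (y - H *ᵥ a) with he
  set b := x - (F *ᵥ a + (F * P * Hᵀ * (R + H * P * Hᵀ)⁻¹) *ᵥ (y - H *ᵥ a)) with hb
  have hFe : b = x - (F *ᵥ a + F *ᵥ e) := by
    rw [hb, he, mulVec_mulVec]
    simp only [Matrix.mul_assoc]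
  set D := (L⁻¹)⁻¹ + Fᵀ * Q⁻¹ * F with hDdef
  set g := (L⁻¹ * Fᵀ * (Q + F * L⁻¹ * Fᵀ)⁻¹) *ᵥ b with hg
  have key : ∀ z, qf P⁻¹ (z - a) + (qf Q⁻¹ (x - F *ᵥ z) + qf R⁻¹ (y - H *ᵥ z)) =
      qf (Q + F * L⁻¹ * Fᵀ)⁻¹ b + qf (R + H * P * Hᵀ)⁻¹ (H *ᵥ a - y) +
        qf D (z - a - e - g) := fun z => by
    have h₁ := qf_inv_add_qf_inv_sub hP hR H (z - a) (y - H *ᵥ a)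
    have h₂ := qf_inv_add_qf_inv_sub hL.inv hQ F (z - a - e) b
    have e₁ : y - H *ᵥ a - H *ᵥ (z - a) = y - H *ᵥ z := by
      rw [mulVec_sub]; abel
    have e₂ : b - F *ᵥ (z - a - e) = x - F *ᵥ z := by
      rw [hFe, mulVec_sub, mulVec_sub]; abel
    rw [e₁, ← hLdef, ← he, ← neg_sub (H *ᵥ a), qf_neg] at h₁
    rw [e₂, ← hDdef, ← hg,
      nonsing_inv_nonsing_inv _ ((isUnit_iff_isUnit_det L).1 hL.isUnit)] at h₂
    linarith
  refine ⟨⟨a + e + g, ?_⟩, ?_⟩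
  · have h0 : a + e + g - a - e - g = 0 := by abel
    simp only [key, h0]
    simp [qf]
  · rintro _ ⟨z, rfl⟩
    simp only [key]
    exact le_add_of_nonneg_right (qf_nonneg (posDef_information hL.inv hQ F) _)

/-- (Lemma 1, forward dynamic programming / Kalman filter value function.)
For every `t` and `x`, the infimum defining `V_t(x)` (over trajectories ending at
`x` at time `t`) is attained and equals `|x − x̆_t|²_{P_t⁻¹} + c_t`, where `P`, `x̆`,
`c` follow the Kalman recursions. -/
theorem forward_dp_value_function {n m : ℕ}
    (F : Matrix (Fin n) (Fin n) ℝ) (H : Matrix (Fin m) (Fin n) ℝ)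
    (Q P₀ : Matrix (Fin n) (Fin n) ℝ) (R : Matrix (Fin m) (Fin m) ℝ)
    (hQ : Q.PosDef) (hP₀ : P₀.PosDef) (hR : R.PosDef)
    (xh₀ : Fin n → ℝ) (y : ℕ → Fin m → ℝ)
    (P : ℕ → Matrix (Fin n) (Fin n) ℝ)
    (xbr : ℕ → Fin n → ℝ) (c : ℕ → ℝ)
    (hP0 : P 0 = P₀)
    (hPrec : ∀ t, P (t + 1) =
      Q + F * P t * Fᵀ - F * P t * Hᵀ * (R + H * P t * Hᵀ)⁻¹ * (H * P t * Fᵀ))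
    (hx0 : xbr 0 = xh₀)
    (hxrec : ∀ t, xbr (t + 1) =
      F *ᵥ xbr t + (F * P t * Hᵀ * (R + H * P t * Hᵀ)⁻¹) *ᵥ (y t - H *ᵥ xbr t))
    (hc0 : c 0 = 0)
    (hcrec : ∀ t, c (t + 1) = c t + qf (R + H * P t * Hᵀ)⁻¹ (H *ᵥ xbr t - y t)) :
    ∀ (t : ℕ) (x : Fin n → ℝ),
      IsLeast
        {J : ℝ | ∃ ξ : ℕ → Fin n → ℝ, ξ t = x ∧
          J = qf P₀⁻¹ (ξ 0 - xh₀) +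
            ∑ k ∈ Finset.range t,
              (qf Q⁻¹ (ξ (k + 1) - F *ᵥ ξ k) + qf R⁻¹ (y k - H *ᵥ ξ k))}
        (qf (P t)⁻¹ (x - xbr t) + c t) := by
  have hPpos : ∀ t, (P t).PosDef := by
    intro t
    induction t with
    | zero => rwa [hP0]
    | succ t ih =>
      rw [hPrec, riccati_eq F H Q ih hR]
      exact posDef_add_mul_mul_transpose hQ (posDef_information ih hR H).inv F
  have step := fun t x =>
    isLeast_range_kalman_step F H (hPpos t) hQ hR (xbr t) x (y t)
  simp only [← hPrec, ← hxrec] at step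
  intro t
  induction t with
  | zero =>
    intro x
    refine ⟨⟨fun _ => x, rfl, by simp [hP0, hx0, hc0]⟩, ?_⟩
    rintro _ ⟨ξ, rfl, rfl⟩
    simp [hP0, hx0, hc0]
  | succ t ih =>
    intro x
    constructor
    · obtain ⟨z, hz⟩ := (step t x).1
      obtain ⟨ξ, hξt, hξ⟩ := (ih z).1
      refine ⟨fun k => if k ≤ t then ξ k else x, by simp, ?_⟩
      have hsum : ∀ k ∈ Finset.range t,
          qf Q⁻¹ ((if k + 1 ≤ t then ξ (k + 1) else x) - F *ᵥ (if k ≤ t then ξ k else x)) +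
            qf R⁻¹ (y k - H *ᵥ (if k ≤ t then ξ k else x)) =
          qf Q⁻¹ (ξ (k + 1) - F *ᵥ ξ k) + qf R⁻¹ (y k - H *ᵥ ξ k) := fun k hk => by
        have hk' := Finset.mem_range.1 hk
        rw [if_pos (Nat.succ_le_of_lt hk'), if_pos hk'.le]
      rw [Finset.sum_range_succ, Finset.sum_congr rfl hsum]
      simp only [Nat.zero_le, if_true, le_refl, Nat.not_succ_le_self, if_false, hξt]
      rw [hcrec]
      linarith
    · rintro _ ⟨ξ, rfl, rfl⟩
      have h₁ := (ih (ξ t)).2 ⟨ξ, rfl, rfl⟩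
      have h₂ := (step t (ξ (t + 1))).2 ⟨ξ t, rfl⟩
      rw [Finset.sum_range_succ, hcrec]
      linarith
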